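/- For any n-qubit unitary U and any n-qubit stabilizer state |ψ⟩ = C|0⟩^{⊗n} with C Clifford, the unitary stabilizer nullity dominates the state stabilizer nullity of the output: v(U) ≥ v_s(U|ψ⟩). Equivalently 2^n · s(U) ≤ 4^n · s(U|ψ⟩). -/

import Mathlib

open Matrix Complex
open scoped Matrix ComplexConjugate Pointwise

noncomputable section

/-- `n`-qubit operators: matrices indexed by computational basis strings. -/
abbrev QOp (n : ℕ) := Matrix (Fin n → Fin 2) (Fin n → Fin 2) ℂ

/-- `n`-qubit state vectors. -/
abbrev QVec (n : ℕ) := (Fin n → Fin 2) → ℂ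

/-- Labels of the quotient Pauli group: one pair of bits `(a,b)` (meaning `X^a Z^b`
up to phase, i.e. `I, X, Y, Z`) per qubit.  This is the standard symplectic
encoding of the strings `{0,1,2,3}^n`, with the additive (Klein) group structure
being exactly multiplication in the Pauli group modulo phases. -/
abbrev PauliLabel (n : ℕ) := Fin n → ZMod 2 × ZMod 2

def pauliX : Matrix (Fin 2) (Fin 2) ℂ := !![0,1;1,0]
def pauliY : Matrix (Fin 2) (Fin 2) ℂ := !![0,-Complex.I;Complex.I,0]
def pauliZ : Matrix (Fin 2) (Fin 2) ℂ := !![1,0;0,-1]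

/-- The single-qubit Pauli matrix with label `(a,b)`: `I, X, Y, Z`. -/
def pauli1 (ab : ZMod 2 × ZMod 2) : Matrix (Fin 2) (Fin 2) ℂ :=
  if ab = (0,0) then 1 else if ab = (1,0) then pauliX
  else if ab = (1,1) then pauliY else pauliZ

/-- The Pauli string `σ_u = σ_{u_1} ⊗ ⋯ ⊗ σ_{u_n}`. -/
def pauliStr {n : ℕ} (u : PauliLabel n) : QOp n :=
  Matrix.of fun x y => ∏ k, pauli1 (u k) (x k) (y k)

/-- The unitary Pauli function `P_U(u|v) = tr(σ_u U σ_v U†)/2^n`. -/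
def PauliFun {n : ℕ} (U : QOp n) (u v : PauliLabel n) : ℂ :=
  (pauliStr u * U * pauliStr v * Uᴴ).trace / 2 ^ n

/-- `s(U)`: the number of pairs `(u,v)` with `P_U(u|v) = ±1`. -/
def sU {n : ℕ} (U : QOp n) : ℕ :=
  Set.ncard {p : PauliLabel n × PauliLabel n |
    PauliFun U p.1 p.2 = 1 ∨ PauliFun U p.1 p.2 = -1}

/-- The unitary stabilizer nullity `v(U) = 2n − log₂ s(U)`. -/
def nullity {n : ℕ} (U : QOp n) : ℝ := 2 * n - Real.logb 2 (sU U)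

/-- The state Pauli function `P_{|ψ⟩}(u) = ⟨ψ|σ_u|ψ⟩`. -/
def statePauliFun {n : ℕ} (ψ : QVec n) (u : PauliLabel n) : ℂ :=
  star ψ ⬝ᵥ (pauliStr u).mulVec ψ

/-- `s(|ψ⟩)`: number of labels `u` with `⟨ψ|σ_u|ψ⟩ = ±1`. -/
def sState {n : ℕ} (ψ : QVec n) : ℕ :=
  Set.ncard {u : PauliLabel n | statePauliFun ψ u = 1 ∨ statePauliFun ψ u = -1}

/-- The state stabilizer nullity `v_s(|ψ⟩) = n − log₂ s(|ψ⟩)`. -/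
def stateNullity {n : ℕ} (ψ : QVec n) : ℝ := n - Real.logb 2 (sState ψ)

/-- The `n`-qubit Pauli group with phases `±1, ±i`, as a set of matrices. -/
def fullPauliGroup (n : ℕ) : Set (QOp n) :=
  {P | ∃ (c : ℂ) (u : PauliLabel n),
    (c = 1 ∨ c = -1 ∨ c = Complex.I ∨ c = -Complex.I) ∧ P = c • pauliStr u}

/-- A Clifford unitary: a unitary with `U P̂_n U† = P̂_n`. -/
def IsClifford {n : ℕ} (U : QOp n) : Prop :=
  U ∈ Matrix.unitaryGroup (Fin n → Fin 2) ℂ ∧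
    (fun P => U * P * Uᴴ) '' fullPauliGroup n = fullPauliGroup n

/-- The subgroup (as a set of labels) associated with `U`:
`P_U = (U P_n U†) ∩ P_n` modulo phases. -/
def PsubU {n : ℕ} (U : QOp n) : Set (PauliLabel n) :=
  {u | ∃ (v : PauliLabel n) (c : ℂ),
    (c = 1 ∨ c = -1 ∨ c = Complex.I ∨ c = -Complex.I) ∧
      U * pauliStr v * Uᴴ = c • pauliStr u}

/-- Tensor product of an `n`-qubit and an `m`-qubit operator. -/
def tensorOp {n m : ℕ} (U : QOp n) (V : QOp m) : QOp (n + m) :=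
  Matrix.of fun x y =>
    U (fun i => x (Fin.castAdd m i)) (fun i => y (Fin.castAdd m i)) *
    V (fun j => x (Fin.natAdd n j)) (fun j => y (Fin.natAdd n j))

/-- The first `n` symbols of a label on `n+m` qubits. -/
def fstLab {n m : ℕ} (u : PauliLabel (n + m)) : PauliLabel n :=
  fun i => u (Fin.castAdd m i)

/-- The last `m` symbols of a label on `n+m` qubits. -/
def sndLab {n m : ℕ} (u : PauliLabel (n + m)) : PauliLabel m :=
  fun j => u (Fin.natAdd n j)

/-- The T gate acting on qubit `q` (tensored with identity elsewhere). -/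
def TgateOn (n : ℕ) (q : Fin n) : QOp n :=
  Matrix.of fun x y =>
    if x = y then (if x q = 0 then 1 else Complex.exp (Complex.I * (Real.pi / 4))) else 0

/-- The single-qubit T gate `diag(1, e^{iπ/4})`. -/
def Tgate : QOp 1 := TgateOn 1 0

/-- The `n`-fold tensor power of the Hadamard gate. -/
def HadN (n : ℕ) : QOp n :=
  Matrix.of fun x y =>
    ∏ k, ((1 / (Real.sqrt 2) : ℂ) * (if x k = 1 ∧ y k = 1 then -1 else 1))

/-- The multi-controlled Z gate `C^{n-1}Z`. -/
def CnZ (n : ℕ) : QOp n :=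
  Matrix.of fun x y => if x = y then (if ∀ k, x k = 1 then -1 else 1) else 0

/-- The computational basis state `|0⟩^{⊗n}`. -/
def ket0 (n : ℕ) : QVec n := fun x => if x = fun _ => (0 : Fin 2) then 1 else 0

/-- The state `|+⟩^{⊗n}`. -/
def ketPlus (n : ℕ) : QVec n := fun _ => (1 / (Real.sqrt 2 : ℂ)) ^ n

/-- The `2n`-qubit maximally entangled state `2^{-n/2} ∑_x |x⟩|x⟩`. -/
def maxEnt (n : ℕ) : QVec (n + n) := fun x =>
  if (fun i => x (Fin.castAdd n i)) = (fun j => x (Fin.natAdd n j))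
  then (1 / (Real.sqrt 2 : ℂ)) ^ n else 0

end

section KroneckerPower

variable {n : ℕ}

/-- The tensor product of a family of single-qubit operators. -/
def tensorPi (A : Fin n → Matrix (Fin 2) (Fin 2) ℂ) : QOp n :=
  Matrix.of fun x y => ∏ k, A k (x k) (y k)

theorem tensorPi_mul (A B : Fin n → Matrix (Fin 2) (Fin 2) ℂ) :
    tensorPi A * tensorPi B = tensorPi fun k => A k * B k := by
  ext x y
  simp only [tensorPi, Matrix.mul_apply, Matrix.of_apply, ← Finset.prod_mul_distrib]
  rw [Finset.prod_univ_sum, Fintype.piFinset_univ]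

theorem trace_tensorPi (A : Fin n → Matrix (Fin 2) (Fin 2) ℂ) :
    (tensorPi A).trace = ∏ k, (A k).trace := by
  simp only [tensorPi, Matrix.trace, Matrix.diag_apply, Matrix.of_apply]
  rw [Finset.prod_univ_sum, Fintype.piFinset_univ]

theorem tensorPi_smul (c : Fin n → ℂ) (A : Fin n → Matrix (Fin 2) (Fin 2) ℂ) :
    tensorPi (fun k => c k • A k) = (∏ k, c k) • tensorPi A := by
  ext x y
  simp [tensorPi, Finset.prod_mul_distrib]

theorem tensorPi_one : tensorPi (fun _ : Fin n => 1) = 1 := by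
  ext x y
  simp only [tensorPi, Matrix.of_apply, Matrix.one_apply]
  rw [Fintype.prod_ite_zero]
  simp [funext_iff]

end KroneckerPower

section SingleQubit

theorem pauli1_zero_zero : pauli1 (0, 0) = !![1, 0; 0, 1] := by
  simp [pauli1, Matrix.one_fin_two]

theorem pauli1_one_zero : pauli1 (1, 0) = !![0, 1; 1, 0] := by
  simp [pauli1, pauliX]

theorem pauli1_one_one : pauli1 (1, 1) = !![0, -Complex.I; Complex.I, 0] := by
  simp [pauli1, pauliY]

theorem pauli1_zero_one : pauli1 (0, 1) = !![1, 0; 0, -1] := by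
  simp [pauli1, pauliZ]

theorem bitPair_cases (a : ZMod 2 × ZMod 2) :
    a = (0, 0) ∨ a = (1, 0) ∨ a = (1, 1) ∨ a = (0, 1) := by
  revert a
  decide

theorem pauli1_mul_self (a : ZMod 2 × ZMod 2) : pauli1 a * pauli1 a = 1 := by
  rcases bitPair_cases a with rfl | rfl | rfl | rfl <;>
    simp [pauli1_zero_zero, pauli1_one_zero, pauli1_one_one, pauli1_zero_one,
      Matrix.one_fin_two]

theorem pauli1_isHermitian (a : ZMod 2 × ZMod 2) : (pauli1 a)ᴴ = pauli1 a := by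
  rcases bitPair_cases a with rfl | rfl | rfl | rfl <;> ext i j <;> fin_cases i <;>
    fin_cases j <;>
    simp [pauli1_zero_zero, pauli1_one_zero, pauli1_one_one, pauli1_zero_one]

theorem pauli1_add (a b : ZMod 2 × ZMod 2) :
    ∃ c : ℂ, pauli1 (a + b) = c • (pauli1 a * pauli1 b) := by
  have h11 : (1 : ZMod 2) + 1 = 0 := rfl
  rcases bitPair_cases a with rfl | rfl | rfl | rfl <;>
    rcases bitPair_cases b with rfl | rfl | rfl | rfl <;>
    simp only [Prod.mk_add_mk, add_zero, zero_add, h11, pauli1_zero_zero, pauli1_one_zero,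
      pauli1_one_one, pauli1_zero_one] <;>
    first
    | (refine ⟨1, ?_⟩; simp; done)
    | (refine ⟨Complex.I, ?_⟩; simp; done)
    | (refine ⟨-Complex.I, ?_⟩; simp)

theorem trace_pauli1_mul_of_ne {a b : ZMod 2 × ZMod 2} (h : a ≠ b) :
    (pauli1 a * pauli1 b).trace = 0 := by
  rcases bitPair_cases a with rfl | rfl | rfl | rfl <;>
    rcases bitPair_cases b with rfl | rfl | rfl | rfl <;>
    first
    | exact absurd rfl h
    | simp [pauli1_zero_zero, pauli1_one_zero, pauli1_one_one, pauli1_zero_one,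
        Matrix.trace_fin_two]

theorem pauli1_zero_left_apply_zero (b : ZMod 2) (i : Fin 2) :
    pauli1 (0, b) i 0 = if i = 0 then 1 else 0 := by
  have hb : b = 0 ∨ b = 1 := by
    revert b
    decide
  rcases hb with rfl | rfl <;> fin_cases i <;> simp [pauli1_zero_zero, pauli1_zero_one]

end SingleQubit

section PauliStrings

variable {n : ℕ}

theorem pauliStr_eq_tensorPi (u : PauliLabel n) :
    pauliStr u = tensorPi fun k => pauli1 (u k) := rfl

theorem pauliStr_mul_self (u : PauliLabel n) : pauliStr u * pauliStr u = 1 := by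
  simp only [pauliStr_eq_tensorPi, tensorPi_mul, pauli1_mul_self, tensorPi_one]

theorem pauliStr_zero : pauliStr (0 : PauliLabel n) = 1 := by
  have h : pauli1 0 = 1 := pauli1_zero_zero.trans Matrix.one_fin_two.symm
  simp only [pauliStr_eq_tensorPi, Pi.zero_apply, h, tensorPi_one]

theorem pauliStr_isHermitian (u : PauliLabel n) : (pauliStr u)ᴴ = pauliStr u := by
  ext x y
  simp only [pauliStr, Matrix.conjTranspose_apply, Matrix.of_apply, star_prod]
  refine Finset.prod_congr rfl fun k _ => ?_
  rw [← Matrix.conjTranspose_apply, pauli1_isHermitian]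

theorem pauliStr_add (u v : PauliLabel n) :
    ∃ c : ℂ, pauliStr (u + v) = c • (pauliStr u * pauliStr v) := by
  choose c hc using fun k => pauli1_add (u k) (v k)
  refine ⟨∏ k, c k, ?_⟩
  simp only [pauliStr_eq_tensorPi, tensorPi_mul, ← tensorPi_smul, Pi.add_apply, hc]

theorem pauliStr_ne_zero (u : PauliLabel n) : pauliStr u ≠ 0 := by
  intro h
  have := pauliStr_mul_self u
  simp [h] at this

theorem trace_one_qubits : (1 : QOp n).trace = 2 ^ n := by
  simp [Matrix.trace_one]

theorem eq_of_pauliStr_eq_smul {u v : PauliLabel n} {c : ℂ}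
    (h : pauliStr u = c • pauliStr v) : u = v := by
  have hc : c ≠ 0 := by
    rintro rfl
    exact pauliStr_ne_zero u (by simpa using h)
  have htr : (pauliStr u * pauliStr v).trace ≠ 0 := by
    rw [h, Matrix.smul_mul, pauliStr_mul_self, Matrix.trace_smul, trace_one_qubits]
    simp [hc]
  simp only [pauliStr_eq_tensorPi, tensorPi_mul, trace_tensorPi] at htr
  rw [Finset.prod_ne_zero_iff] at htr
  funext k
  by_contra hk
  exact htr k (Finset.mem_univ k) (trace_pauli1_mul_of_ne hk)

theorem pauliStr_zLabel_mulVec_ket0 (b : Fin n → ZMod 2) :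
    (pauliStr fun k => ((0 : ZMod 2), b k)) *ᵥ ket0 n = ket0 n := by
  ext x
  simp only [Matrix.mulVec, dotProduct, ket0, mul_ite, mul_one, mul_zero,
    Finset.sum_ite_eq', Finset.mem_univ, if_true, pauliStr, Matrix.of_apply,
    pauli1_zero_left_apply_zero]
  rw [Fintype.prod_ite_zero]
  simp [funext_iff]

end PauliStrings

section Conjugation

variable {n : ℕ} {U : QOp n}

theorem conjTranspose_mul_self_of_unitary (hU : U ∈ Matrix.unitaryGroup (Fin n → Fin 2) ℂ) :
    Uᴴ * U = 1 := Matrix.mem_unitaryGroup_iff'.mp hU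

theorem mul_conjTranspose_self_of_unitary (hU : U ∈ Matrix.unitaryGroup (Fin n → Fin 2) ℂ) :
    U * Uᴴ = 1 := Matrix.mem_unitaryGroup_iff.mp hU

theorem conj_mul_conj (hU : U ∈ Matrix.unitaryGroup (Fin n → Fin 2) ℂ) (A B : QOp n) :
    (U * A * Uᴴ) * (U * B * Uᴴ) = U * (A * B) * Uᴴ := by
  calc (U * A * Uᴴ) * (U * B * Uᴴ) = U * A * (Uᴴ * U) * B * Uᴴ := by
        simp only [Matrix.mul_assoc]
    _ = U * (A * B) * Uᴴ := by
        rw [conjTranspose_mul_self_of_unitary hU, Matrix.mul_one, Matrix.mul_assoc U]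

theorem conj_conj_symm (hU : U ∈ Matrix.unitaryGroup (Fin n → Fin 2) ℂ) (A : QOp n) :
    Uᴴ * (U * A * Uᴴ) * U = A := by
  calc Uᴴ * (U * A * Uᴴ) * U = (Uᴴ * U) * A * (Uᴴ * U) := by
        simp only [Matrix.mul_assoc]
    _ = A := by rw [conjTranspose_mul_self_of_unitary hU, Matrix.mul_one, Matrix.one_mul]

theorem mul_self_eq_one_of_conj_pauliStr (hU : U ∈ Matrix.unitaryGroup (Fin n → Fin 2) ℂ)
    {u v : PauliLabel n} {c : ℂ} (h : U * pauliStr v * Uᴴ = c • pauliStr u) : c * c = 1 := by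
  have h1 := conj_mul_conj hU (pauliStr v) (pauliStr v)
  rw [pauliStr_mul_self, Matrix.mul_one, mul_conjTranspose_self_of_unitary hU, h,
    Matrix.smul_mul, Matrix.mul_smul, pauliStr_mul_self, smul_smul] at h1
  have h2 := congrFun (congrFun h1 0) 0
  simpa using h2

theorem eq_of_conj_pauliStr_eq (hU : U ∈ Matrix.unitaryGroup (Fin n → Fin 2) ℂ)
    {u v w : PauliLabel n} {c d : ℂ} (hv : U * pauliStr v * Uᴴ = c • pauliStr u)
    (hw : U * pauliStr w * Uᴴ = d • pauliStr u) : v = w := by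
  have hd := mul_self_eq_one_of_conj_pauliStr hU hw
  have hu : pauliStr u = d • (U * pauliStr w * Uᴴ) := by
    rw [hw, smul_smul, hd, one_smul]
  refine eq_of_pauliStr_eq_smul (c := c * d) ?_
  rw [← conj_conj_symm hU (pauliStr v), hv, hu, smul_smul, Matrix.mul_smul, Matrix.smul_mul,
    conj_conj_symm hU]

open scoped ComplexOrder in
theorem eq_of_trace_mul_eq {M N : QOp n} (hM : Mᴴ = M) (hN : Nᴴ = N) (hMM : M * M = 1)
    (hNN : N * N = 1) (h : (M * N).trace = 2 ^ n) : N = M := by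
  have h0 : ((N - M)ᴴ * (N - M)).trace = 0 := by
    rw [Matrix.conjTranspose_sub, hM, hN, Matrix.sub_mul, Matrix.mul_sub, Matrix.mul_sub, hMM,
      hNN, Matrix.trace_sub, Matrix.trace_sub, Matrix.trace_sub, Matrix.trace_mul_comm N M, h,
      trace_one_qubits]
    ring
  exact sub_eq_zero.mp (Matrix.trace_conjTranspose_mul_self_eq_zero_iff.mp h0)

theorem conj_pauliStr_of_pauliFun (hU : U ∈ Matrix.unitaryGroup (Fin n → Fin 2) ℂ)
    {u v : PauliLabel n} (h : PauliFun U u v = 1 ∨ PauliFun U u v = -1) :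
    ∃ c : ℂ, U * pauliStr v * Uᴴ = c • pauliStr u := by
  have h2 : (2 : ℂ) ^ n ≠ 0 := by simp
  have hN : (U * pauliStr v * Uᴴ)ᴴ = U * pauliStr v * Uᴴ := by
    simp [Matrix.conjTranspose_mul, pauliStr_isHermitian, Matrix.mul_assoc]
  have hNN : (U * pauliStr v * Uᴴ) * (U * pauliStr v * Uᴴ) = 1 := by
    rw [conj_mul_conj hU, pauliStr_mul_self, Matrix.mul_one, mul_conjTranspose_self_of_unitary hU]
  have hassoc : pauliStr u * U * pauliStr v * Uᴴ = pauliStr u * (U * pauliStr v * Uᴴ) := by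
    simp only [Matrix.mul_assoc]
  unfold PauliFun at h
  rw [hassoc, div_eq_iff h2, div_eq_iff h2] at h
  rcases h with h | h
  · exact ⟨1, by
      rw [one_smul]
      exact eq_of_trace_mul_eq (pauliStr_isHermitian u) hN (pauliStr_mul_self u) hNN
        (by rw [h, one_mul])⟩
  · refine ⟨-1, ?_⟩
    rw [neg_one_smul]
    refine eq_of_trace_mul_eq ?_ hN ?_ hNN ?_
    · rw [Matrix.conjTranspose_neg, pauliStr_isHermitian]
    · rw [neg_mul_neg, pauliStr_mul_self]
    · rw [Matrix.neg_mul, Matrix.trace_neg, h]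
      ring

end Conjugation

section Subgroups

variable {n : ℕ}

theorem PauliLabel.neg_eq (v : PauliLabel n) : -v = v := by
  funext k
  ext <;> simp [ZMod.neg_eq_self_mod_two]

/-- Labels of the Pauli strings which `U` conjugates to multiples of Pauli strings. -/
def conjLabels (U : QOp n) (hU : U ∈ Matrix.unitaryGroup (Fin n → Fin 2) ℂ) :
    AddSubgroup (PauliLabel n) where
  carrier := {v | ∃ (u : PauliLabel n) (c : ℂ), U * pauliStr v * Uᴴ = c • pauliStr u}
  zero_mem' := ⟨0, 1, by
    rw [pauliStr_zero, Matrix.mul_one, mul_conjTranspose_self_of_unitary hU, one_smul]⟩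
  add_mem' := by
    rintro v w ⟨u, c, hu⟩ ⟨u', c', hu'⟩
    obtain ⟨a, ha⟩ := pauliStr_add v w
    obtain ⟨b, hb⟩ := pauliStr_add u u'
    have hb0 : b ≠ 0 := by
      rintro rfl
      exact pauliStr_ne_zero _ (by simpa using hb)
    refine ⟨u + u', a * (c * c') * b⁻¹, ?_⟩
    rw [hb, ha, Matrix.mul_smul, Matrix.smul_mul, ← conj_mul_conj hU, hu, hu', Matrix.smul_mul,
      Matrix.mul_smul, smul_smul, smul_smul, smul_smul, mul_assoc (a * (c * c')),
      inv_mul_cancel₀ hb0, mul_one, mul_assoc]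
  neg_mem' := by
    intro v hv
    rwa [PauliLabel.neg_eq]

/-- Labels of the Pauli strings having `ψ` as an eigenvector. -/
def stabLabels (ψ : QVec n) : AddSubgroup (PauliLabel n) where
  carrier := {v | ∃ c : ℂ, pauliStr v *ᵥ ψ = c • ψ}
  zero_mem' := ⟨1, by rw [pauliStr_zero, Matrix.one_mulVec, one_smul]⟩
  add_mem' := by
    rintro v w ⟨c, hc⟩ ⟨d, hd⟩
    obtain ⟨a, ha⟩ := pauliStr_add v w
    refine ⟨a * (d * c), ?_⟩
    rw [ha, Matrix.smul_mulVec, ← Matrix.mulVec_mulVec, hd, Matrix.mulVec_smul, hc, smul_smul,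
      smul_smul, mul_assoc]
  neg_mem' := by
    intro v hv
    rwa [PauliLabel.neg_eq]

theorem sU_le_card_conjLabels {U : QOp n} (hU : U ∈ Matrix.unitaryGroup (Fin n → Fin 2) ℂ) :
    sU U ≤ Nat.card (conjLabels U hU) := by
  rw [← SetLike.coe_sort_coe, Nat.card_coe_set_eq]
  refine Set.ncard_le_ncard_of_injOn Prod.snd ?_ ?_ (Set.toFinite _)
  · rintro ⟨u, v⟩ h
    exact ⟨u, conj_pauliStr_of_pauliFun hU h⟩
  · rintro ⟨u, v⟩ h ⟨u', v'⟩ h' (rfl : v = v')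
    obtain ⟨c, hc⟩ := conj_pauliStr_of_pauliFun hU h
    obtain ⟨d, hd⟩ := conj_pauliStr_of_pauliFun hU h'
    have hcc := mul_self_eq_one_of_conj_pauliStr hU hc
    rw [hc] at hd
    have : u = u' := eq_of_pauliStr_eq_smul (c := c * d) (by
      rw [mul_smul, ← hd, smul_smul, hcc, one_smul])
    rw [this]

theorem two_pow_le_card_stabLabels {C : QOp n} (hC : IsClifford C) :
    2 ^ n ≤ Nat.card (stabLabels (C *ᵥ ket0 n)) := by
  obtain ⟨hU, hCl⟩ := hC
  have himage (b : Fin n → ZMod 2) : ∃ (u : PauliLabel n) (c : ℂ),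
      C * pauliStr (fun k => ((0 : ZMod 2), b k)) * Cᴴ = c • pauliStr u := by
    have hmem : C * pauliStr (fun k => ((0 : ZMod 2), b k)) * Cᴴ ∈ fullPauliGroup n := by
      rw [← hCl]
      exact ⟨_, ⟨1, _, Or.inl rfl, (one_smul _ _).symm⟩, rfl⟩
    obtain ⟨c, u, -, h⟩ := hmem
    exact ⟨u, c, h⟩
  choose f c hf using himage
  have hmem (b : Fin n → ZMod 2) : f b ∈ stabLabels (C *ᵥ ket0 n) := by
    refine ⟨c b, ?_⟩
    have hcc := mul_self_eq_one_of_conj_pauliStr hU (hf b)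
    have hu : pauliStr (f b) = c b • (C * pauliStr (fun k => ((0 : ZMod 2), b k)) * Cᴴ) := by
      rw [hf, smul_smul, hcc, one_smul]
    rw [hu, Matrix.smul_mulVec, Matrix.mulVec_mulVec, Matrix.mul_assoc, Matrix.mul_assoc,
      conjTranspose_mul_self_of_unitary hU, Matrix.mul_one, ← Matrix.mulVec_mulVec,
      pauliStr_zLabel_mulVec_ket0]
  have hinj : Function.Injective fun b => (⟨f b, hmem b⟩ : stabLabels (C *ᵥ ket0 n)) := by
    intro b b' h
    have hfb : f b = f b' := congrArg Subtype.val h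
    have hb := hf b
    rw [hfb] at hb
    have := eq_of_conj_pauliStr_eq hU hb (hf b')
    funext k
    exact congrArg Prod.snd (congrFun this k)
  simpa using Nat.card_le_card_of_injective _ hinj

theorem card_inf_le_sState {U : QOp n} (hU : U ∈ Matrix.unitaryGroup (Fin n → Fin 2) ℂ)
    {ψ : QVec n} (hψ : star ψ ⬝ᵥ ψ = 1) :
    Nat.card (conjLabels U hU ⊓ stabLabels ψ : AddSubgroup (PauliLabel n)) ≤
      sState (U *ᵥ ψ) := by
  have hconj (v : (conjLabels U hU ⊓ stabLabels ψ : AddSubgroup (PauliLabel n))) :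
      ∃ (u : PauliLabel n) (c : ℂ), U * pauliStr v.1 * Uᴴ = c • pauliStr u := v.2.1
  choose f c hf using hconj
  have hmem (v : (conjLabels U hU ⊓ stabLabels ψ : AddSubgroup (PauliLabel n))) :
      f v ∈ {u | statePauliFun (U *ᵥ ψ) u = 1 ∨ statePauliFun (U *ᵥ ψ) u = -1} := by
    obtain ⟨d, hd⟩ := v.2.2
    have hcc := mul_self_eq_one_of_conj_pauliStr hU (hf v)
    have hdd : d * d = 1 := by
      have h1 : pauliStr v.1 *ᵥ (pauliStr v.1 *ᵥ ψ) = ψ := by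
        rw [Matrix.mulVec_mulVec, pauliStr_mul_self, Matrix.one_mulVec]
      rw [hd, Matrix.mulVec_smul, hd, smul_smul] at h1
      simpa [hψ] using congrArg (fun φ => star ψ ⬝ᵥ φ) h1
    have hu : pauliStr (f v) = c v • (U * pauliStr v.1 * Uᴴ) := by
      rw [hf, smul_smul, hcc, one_smul]
    have hval : statePauliFun (U *ᵥ ψ) (f v) = c v * d := by
      rw [statePauliFun, hu, Matrix.smul_mulVec, Matrix.mulVec_mulVec, Matrix.mul_assoc,
        conjTranspose_mul_self_of_unitary hU, Matrix.mul_one, ← Matrix.mulVec_mulVec, hd,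
        Matrix.mulVec_smul, smul_smul, dotProduct_smul, Matrix.star_mulVec,
        ← Matrix.dotProduct_mulVec, Matrix.mulVec_mulVec, conjTranspose_mul_self_of_unitary hU,
        Matrix.one_mulVec, hψ, smul_eq_mul, mul_one]
    rw [Set.mem_ofPred_eq, hval]
    exact mul_self_eq_one_iff.mp (by linear_combination hcc * (d * d) + hdd)
  have hinj : Function.Injective fun v =>
      (⟨f v, hmem v⟩ :
        {u | statePauliFun (U *ᵥ ψ) u = 1 ∨ statePauliFun (U *ᵥ ψ) u = -1}) := by
    intro v w h
    have hfv : f v = f w := congrArg Subtype.val h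
    have hv := hf v
    rw [hfv] at hv
    exact Subtype.ext (eq_of_conj_pauliStr_eq hU hv (hf w))
  rw [sState, ← Nat.card_coe_set_eq]
  exact Nat.card_le_card_of_injective _ hinj

theorem AddSubgroup.card_mul_card_le_card_mul_card_inf {G : Type*} [AddGroup G] [Finite G]
    (H K : AddSubgroup G) :
    Nat.card H * Nat.card K ≤ Nat.card G * Nat.card (H ⊓ K : AddSubgroup G) := by
  have h1 : (H ⊓ K).relIndex H ≤ K.index := by
    rw [AddSubgroup.inf_relIndex_left, ← AddSubgroup.relIndex_top_right]
    refine AddSubgroup.relIndex_le_of_le_right le_top ?_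
    rw [AddSubgroup.relIndex_top_right]
    exact AddSubgroup.index_ne_zero_of_finite
  calc Nat.card H * Nat.card K
      = Nat.card (H ⊓ K : AddSubgroup G) * (H ⊓ K).relIndex H * Nat.card K := by
        rw [← AddSubgroup.relIndex_bot_left (H ⊓ K),
          AddSubgroup.relIndex_mul_relIndex _ _ _ bot_le inf_le_left,
          AddSubgroup.relIndex_bot_left]
    _ ≤ Nat.card (H ⊓ K : AddSubgroup G) * K.index * Nat.card K := by gcongr
    _ = Nat.card G * Nat.card (H ⊓ K : AddSubgroup G) := by
        rw [← AddSubgroup.card_mul_index K]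
        ring

theorem card_pauliLabel : Nat.card (PauliLabel n) = 4 ^ n := by
  simp [PauliLabel]

theorem sU_pos {U : QOp n} (hU : U ∈ Matrix.unitaryGroup (Fin n → Fin 2) ℂ) : 0 < sU U := by
  rw [sU, Set.ncard_pos (Set.toFinite _)]
  refine ⟨(0, 0), Or.inl ?_⟩
  simp [PauliFun, pauliStr_zero, mul_conjTranspose_self_of_unitary hU]

theorem star_dotProduct_ket0 : star (ket0 n) ⬝ᵥ ket0 n = 1 := by
  simp [dotProduct, ket0]

end Subgroups

theorem unitary_dominates_state_nullity {n : ℕ} (U C : QOp n)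
    (hU : U ∈ Matrix.unitaryGroup (Fin n → Fin 2) ℂ) (hC : IsClifford C)
    (ψ : QVec n) (hψ : ψ = C.mulVec (ket0 n)) :
    2 ^ n * sU U ≤ 4 ^ n * sState (U.mulVec ψ) ∧
      stateNullity (U.mulVec ψ) ≤ nullity U := by
  have hnorm : star ψ ⬝ᵥ ψ = 1 := by
    rw [hψ, Matrix.star_mulVec, ← Matrix.dotProduct_mulVec, Matrix.mulVec_mulVec,
      conjTranspose_mul_self_of_unitary hC.1, Matrix.one_mulVec, star_dotProduct_ket0]
  have hstab : 2 ^ n ≤ Nat.card (stabLabels ψ) := hψ ▸ two_pow_le_card_stabLabels hC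
  have hmain : 2 ^ n * sU U ≤ 4 ^ n * sState (U *ᵥ ψ) :=
    calc 2 ^ n * sU U ≤ Nat.card (stabLabels ψ) * Nat.card (conjLabels U hU) :=
          Nat.mul_le_mul hstab (sU_le_card_conjLabels hU)
      _ = Nat.card (conjLabels U hU) * Nat.card (stabLabels ψ) := mul_comm _ _
      _ ≤ Nat.card (PauliLabel n) *
            Nat.card (conjLabels U hU ⊓ stabLabels ψ : AddSubgroup (PauliLabel n)) :=
          AddSubgroup.card_mul_card_le_card_mul_card_inf _ _
      _ ≤ 4 ^ n * sState (U *ᵥ ψ) := by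
          rw [card_pauliLabel]
          exact Nat.mul_le_mul_left _ (card_inf_le_sState hU hnorm)
  refine ⟨hmain, ?_⟩
  have hUpos := sU_pos hU
  have hSpos : 0 < sState (U *ᵥ ψ) :=
    Nat.pos_of_mul_pos_left (lt_of_lt_of_le (by positivity) hmain)
  have hUpos' : (0 : ℝ) < sU U := by exact_mod_cast hUpos
  have hSpos' : (0 : ℝ) < sState (U *ᵥ ψ) := by exact_mod_cast hSpos
  have hreal : (2 : ℝ) ^ n * sU U ≤ 2 ^ (2 * n) * sState (U *ᵥ ψ) := by
    rw [pow_mul]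
    norm_num
    exact_mod_cast hmain
  have hlog := Real.logb_le_logb_of_le one_lt_two (by positivity) hreal
  rw [Real.logb_mul (by positivity) hUpos'.ne', Real.logb_mul (by positivity) hSpos'.ne',
    Real.logb_pow, Real.logb_pow, Real.logb_self_eq_one one_lt_two] at hlog
  push_cast at hlog
  rw [stateNullity, nullity]
  linarith
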